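/- For every N ≥ 1 and all J, h ∈ ℝ, the Curie-Weiss pressure satisfies the upper bound p_N ≤ (1/N)·ln(N+1) + sup_{m̄∈[−1,1]} p_up(m̄), where p_up(m̄) = ln 2 − (J/2)·m̄² + ln cosh(J·m̄ + h). In particular limsup_{N→∞} p_N ≤ sup_{m̄∈[−1,1]} p_up(m̄). -/

import Mathlib

open Filter

noncomputable section

/-- The value of a spin encoded by a Boolean: `+1` or `-1`. -/
def spin (b : Bool) : ℝ := if b then 1 else -1

/-- Magnetization of a configuration of `N` spins. -/
def mag (N : ℕ) (σ : Fin N → Bool) : ℝ := (∑ i, spin (σ i)) / N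

/-- Curie-Weiss Hamiltonian. -/
def ham (N : ℕ) (J h : ℝ) (σ : Fin N → Bool) : ℝ :=
  -(N * (J / 2 * mag N σ ^ 2 + h * mag N σ))

/-- Curie-Weiss partition function. -/
def Z (N : ℕ) (J h : ℝ) : ℝ := ∑ σ : Fin N → Bool, Real.exp (-ham N J h σ)

/-- Curie-Weiss pressure per particle. -/
def pressure (N : ℕ) (J h : ℝ) : ℝ := Real.log (Z N J h) / N

/-- The variational upper-bound functional for the Curie-Weiss pressure. -/
def pUp (J h m : ℝ) : ℝ := Real.log 2 - J / 2 * m ^ 2 + Real.log (Real.cosh (J * m + h))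

lemma sum_exp_spin (N : ℕ) (a : ℝ) :
    ∑ σ : Fin N → Bool, Real.exp (a * ∑ i, spin (σ i)) = (2 * Real.cosh a) ^ N := by
  have h1 : (2 * Real.cosh a) = ∑ b : Bool, Real.exp (a * spin b) := by
    simp [spin, Real.cosh_eq]
    ring
  rw [h1, Fintype.sum_pow]
  refine Finset.sum_congr rfl fun σ _ => ?_
  rw [← Real.exp_sum, Finset.mul_sum]

lemma sum_spin_eq (N : ℕ) (σ : Fin N → Bool) :
    ∃ k ∈ Finset.range (N + 1), ∑ i, spin (σ i) = 2 * (k : ℝ) - N := by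
  refine ⟨(Finset.univ.filter fun i => σ i = true).card, ?_, ?_⟩
  · rw [Finset.mem_range, Nat.lt_succ_iff]
    simpa using Finset.card_le_univ (Finset.univ.filter fun i => σ i = true)
  · have h1 : ∀ i, spin (σ i) = 2 * (if σ i = true then (1 : ℝ) else 0) - 1 := by
      intro i
      unfold spin
      split_ifs <;> norm_num
    simp only [h1, Finset.sum_sub_distrib, ← Finset.mul_sum, Finset.sum_boole]
    simp

lemma pUp_bdd (J h : ℝ) : BddAbove (pUp J h '' Set.Icc (-1 : ℝ) 1) := by
  refine (isCompact_Icc.image_of_continuousOn ?_).bddAbove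
  apply Continuous.continuousOn
  unfold pUp
  have h1 : Continuous fun m : ℝ => Real.log (Real.cosh (J * m + h)) :=
    Continuous.log (Real.continuous_cosh.comp (by fun_prop)) fun x => (Real.cosh_pos _).ne'
  fun_prop

lemma Z_pos (N : ℕ) (J h : ℝ) : 0 < Z N J h :=
  Finset.sum_pos (fun _ _ => Real.exp_pos _) Finset.univ_nonempty

lemma Z_le (N : ℕ) (hN : 1 ≤ N) (J h : ℝ) :
    Z N J h ≤ (N + 1) * Real.exp (N * sSup (pUp J h '' Set.Icc (-1 : ℝ) 1)) := by
  have hN0 : (0 : ℝ) < N := by exact_mod_cast hN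
  set mk : ℕ → ℝ := fun k => (2 * (k : ℝ) - N) / N with hmk
  have step1 : Z N J h ≤ ∑ σ : Fin N → Bool, ∑ k ∈ Finset.range (N + 1),
      Real.exp (-(N * (J / 2 * mk k ^ 2))) * Real.exp ((J * mk k + h) * ∑ i, spin (σ i)) := by
    refine Finset.sum_le_sum fun σ _ => ?_
    obtain ⟨k, hk, hs⟩ := sum_spin_eq N σ
    refine le_trans (le_of_eq ?_) (Finset.single_le_sum (f := fun k =>
      Real.exp (-(N * (J / 2 * mk k ^ 2))) * Real.exp ((J * mk k + h) * ∑ i, spin (σ i)))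
      (fun _ _ => by positivity) hk)
    simp only [ham, mag, hmk, hs]
    rw [← Real.exp_add]
    congr 1
    field_simp
    ring
  refine step1.trans ?_
  rw [Finset.sum_comm]
  have step2 : ∀ k ∈ Finset.range (N + 1), ∑ σ : Fin N → Bool,
      Real.exp (-(N * (J / 2 * mk k ^ 2))) * Real.exp ((J * mk k + h) * ∑ i, spin (σ i))
      ≤ Real.exp (N * sSup (pUp J h '' Set.Icc (-1 : ℝ) 1)) := by
    intro k hk
    have hkN : (k : ℝ) ≤ N := by exact_mod_cast Nat.lt_succ_iff.mp (Finset.mem_range.mp hk)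
    have hk0 : (0 : ℝ) ≤ k := by positivity
    have hmem : mk k ∈ Set.Icc (-1 : ℝ) 1 := by
      constructor
      · rw [hmk]; simp only; rw [le_div_iff₀ hN0]; linarith
      · rw [hmk]; simp only; rw [div_le_iff₀ hN0]; linarith
    have hle : pUp J h (mk k) ≤ sSup (pUp J h '' Set.Icc (-1 : ℝ) 1) :=
      le_csSup (pUp_bdd J h) ⟨_, hmem, rfl⟩
    rw [← Finset.mul_sum, sum_exp_spin]
    have hc := Real.cosh_pos (J * mk k + h)
    have h2 : (2 * Real.cosh (J * mk k + h)) ^ N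
        = Real.exp (N * (Real.log 2 + Real.log (Real.cosh (J * mk k + h)))) := by
      rw [← Real.log_mul (by norm_num) hc.ne', Real.exp_nat_mul, Real.exp_log (by positivity)]
    rw [h2, ← Real.exp_add]
    apply Real.exp_le_exp.mpr
    refine le_trans (le_of_eq ?_) (mul_le_mul_of_nonneg_left hle hN0.le)
    unfold pUp
    ring
  refine (Finset.sum_le_card_nsmul _ _ _ step2).trans (le_of_eq ?_)
  simp

lemma pressure_le (N : ℕ) (hN : 1 ≤ N) (J h : ℝ) :
    pressure N J h ≤ Real.log (N + 1) / N + sSup (pUp J h '' Set.Icc (-1 : ℝ) 1) := by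
  have hN0 : (0 : ℝ) < N := by exact_mod_cast hN
  have h1 := Real.log_le_log (Z_pos N J h) (Z_le N hN J h)
  rw [Real.log_mul (by positivity) (Real.exp_pos _).ne', Real.log_exp] at h1
  unfold pressure
  rw [div_le_iff₀ hN0, add_mul, div_mul_cancel₀ _ hN0.ne']
  linarith

lemma le_pressure (N : ℕ) (hN : 1 ≤ N) (J h : ℝ) : J / 2 + h ≤ pressure N J h := by
  have hN0 : (0 : ℝ) < N := by exact_mod_cast hN
  unfold pressure
  rw [le_div_iff₀ hN0, Real.le_log_iff_exp_le (Z_pos N J h)]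
  refine le_trans (le_of_eq ?_) (Finset.single_le_sum
    (f := fun σ : Fin N → Bool => Real.exp (-ham N J h σ))
    (fun _ _ => (Real.exp_pos _).le) (Finset.mem_univ (fun _ => true)))
  simp only [ham, mag, spin]
  congr 1
  simp [hN0.ne']
  ring

lemma tendsto_bound (c : ℝ) :
    Tendsto (fun N : ℕ => Real.log (N + 1) / N + c) atTop (nhds c) := by
  have h1 : Tendsto (fun x : ℝ => Real.log x / (x - 1)) atTop (nhds 0) := by
    simpa [sub_eq_add_neg] using
      Real.tendsto_pow_log_div_mul_add_atTop 1 (-1) 1 one_ne_zero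
  have h2 : Tendsto (fun N : ℕ => (N : ℝ) + 1) atTop atTop :=
    tendsto_atTop_add_const_right _ _ tendsto_natCast_atTop_atTop
  have h3 := (h1.comp h2).add_const c
  simpa [Function.comp_def] using h3

/-- Upper bound for the Curie-Weiss pressure:
`p_N ≤ (1/N)·ln(N+1) + sup_{m̄ ∈ [−1,1]} p_up(m̄)` for every `N ≥ 1`; in particular
`limsup_{N→∞} p_N ≤ sup_{m̄ ∈ [−1,1]} p_up(m̄)`. -/
theorem curieWeiss_pressure_upper_bound (J h : ℝ) :
    (∀ N : ℕ, 1 ≤ N →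
      pressure N J h ≤ Real.log (N + 1) / N + sSup (pUp J h '' Set.Icc (-1 : ℝ) 1)) ∧
    limsup (fun N : ℕ => pressure N J h) atTop ≤ sSup (pUp J h '' Set.Icc (-1 : ℝ) 1) := by
  refine ⟨fun N hN => pressure_le N hN J h, ?_⟩
  have ht := tendsto_bound (sSup (pUp J h '' Set.Icc (-1 : ℝ) 1))
  rw [← ht.limsup_eq]
  refine limsup_le_limsup ?_ ?_ ht.isBoundedUnder_le
  · filter_upwards [eventually_ge_atTop 1] with N hN
    exact pressure_le N hN J h
  · refine IsBoundedUnder.isCoboundedUnder_le ⟨J / 2 + h, ?_⟩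
    rw [eventually_map]
    filter_upwards [eventually_ge_atTop 1] with N hN
    exact le_pressure N hN J h
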